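/- Fix θ, σ, t > 0 and 0 ≤ a < b ≤ π. Let u : [0,π] → (Ω → ℝ) be a centered Gaussian random field with covariance E[u(x)u(y)] = Σ_{k=1}^∞ (σ²/(θπk²)) (1 − e^{−2θk²t}) sin(kx) sin(ky), set x_j := a + (b−a)j/m, and define θ̂_{m,t} := (b−a)σ² / ( 2 Σ_{j=1}^m ( u(x_j) − u(x_{j−1}) )² ). Then there exists V > 0 such that the laws of √m (θ̂_{m,t} − θ) converge weakly, as m → ∞, to the centered Gaussian measure on ℝ with variance V. -/

import Mathlib

open MeasureTheory ProbabilityTheory Real Filter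

noncomputable section

/-- `u` is a centered Gaussian random field on `S` with covariance function `C`:
every finite linear combination of its values at points of `S` is a centered real
Gaussian with the corresponding variance. -/
def IsCenteredGaussianField {Ω : Type*} [MeasurableSpace Ω] (P : Measure Ω)
    (u : ℝ → Ω → ℝ) (S : Set ℝ) (C : ℝ → ℝ → ℝ) : Prop :=
  ∀ (n : ℕ) (x : Fin n → ℝ), (∀ i, x i ∈ S) → ∀ a : Fin n → ℝ,
    Measure.map (fun ω => ∑ i, a i * u (x i) ω) P
      = gaussianReal 0 (∑ i, ∑ j, a i * a j * C (x i) (x j)).toNNReal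

/-- Spatial covariance, at a fixed time `t`, of the solution of the stochastic heat
equation `du − θΔu dt = σ dW` on `[0, π]` with zero initial and Dirichlet boundary
conditions: `E[u(x)u(y)] = Σ_{k≥1} (σ²/(θπk²))(1 − e^{−2θk²t}) sin(kx) sin(ky)`. -/
def heatCovSpace (θ σ t x y : ℝ) : ℝ :=
  ∑' k : ℕ, (σ ^ 2 / (θ * π * ((k : ℝ) + 1) ^ 2)) *
    (1 - Real.exp (-(2 * θ * ((k : ℝ) + 1) ^ 2 * t))) *
    Real.sin (((k : ℝ) + 1) * x) * Real.sin (((k : ℝ) + 1) * y)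

lemma hasSum_cos_div_sq {z : ℝ} (hz0 : 0 ≤ z) (hz1 : z ≤ 2 * π) :
    HasSum (fun k : ℕ => Real.cos (((k : ℝ) + 1) * z) / ((k : ℝ) + 1) ^ 2)
      (π ^ 2 / 6 - π * z / 2 + z ^ 2 / 4) := by
  have hπ := Real.pi_pos
  have h := hasSum_one_div_nat_pow_mul_cos (k := 1) one_ne_zero (x := z / (2 * π))
    ⟨by positivity, by rw [div_le_one (by positivity)]; exact hz1⟩
  rw [← hasSum_nat_add_iff' 1] at h
  have hB : (Polynomial.map (algebraMap ℚ ℝ) (Polynomial.bernoulli (2 * 1))).eval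
      (z / (2 * π)) = (z / (2 * π)) ^ 2 - z / (2 * π) + 6⁻¹ :=
    bernoulliFun_two _
  rw [hB] at h
  convert! h using 1
  · ext k
    have : 2 * π * ((k + 1 : ℕ) : ℝ) * (z / (2 * π)) = ((k : ℝ) + 1) * z := by
      push_cast; field_simp
    rw [this]; push_cast; ring
  · simp
    field_simp
    ring

lemma hasSum_sin_mul_sin_div_sq {x y : ℝ} (hx : x ∈ Set.Icc 0 π) (hy : y ∈ Set.Icc 0 π) :
    HasSum (fun k : ℕ => Real.sin (((k : ℝ) + 1) * x) * Real.sin (((k : ℝ) + 1) * y) /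
      ((k : ℝ) + 1) ^ 2) ((π * min x y - x * y) / 2) := by
  wlog hxy : y ≤ x generalizing x y
  · simpa only [min_comm, mul_comm] using this hy hx (le_of_not_ge hxy)
  obtain ⟨hx0, hx1⟩ := hx
  obtain ⟨hy0, hy1⟩ := hy
  have h1 := hasSum_cos_div_sq (z := x - y) (by linarith) (by linarith)
  have h2 := hasSum_cos_div_sq (z := x + y) (by linarith) (by linarith)
  convert! (h1.sub h2).div_const 2 using 1
  · ext k
    rw [mul_sub, mul_add, Real.cos_sub, Real.cos_add]
    ring
  · rw [min_eq_right hxy]; ring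

/-- The increment over the `j`-th cell of the uniform grid of `[a, b]` with `m` cells of
`x ↦ sin ((k + 1) x)`. -/
def sinIncr (a b : ℝ) (m k j : ℕ) : ℝ :=
  Real.sin (((k : ℝ) + 1) * (a + (b - a) * ((j : ℝ) + 1) / (m : ℝ))) -
    Real.sin (((k : ℝ) + 1) * (a + (b - a) * (j : ℝ) / (m : ℝ)))

lemma grid_mem_Icc {a b : ℝ} (ha : 0 ≤ a) (hab : a < b) (hb : b ≤ π) {m : ℕ} {r : ℝ}
    (hr : 0 ≤ r) (hrm : r ≤ m) : a + (b - a) * r / (m : ℝ) ∈ Set.Icc 0 π := by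
  have hba : 0 ≤ b - a := by linarith
  refine ⟨by positivity, ?_⟩
  have : (b - a) * r / m ≤ b - a := by
    rw [mul_div_assoc]
    exact mul_le_of_le_one_right hba (div_le_one_of_le₀ hrm (by positivity))
  linarith

lemma hasSum_sinIncr_mul_div_sq {a b : ℝ} (ha : 0 ≤ a) (hab : a < b) (hb : b ≤ π)
    {m i j : ℕ} (hi : i < m) (hj : j < m) :
    HasSum (fun k : ℕ => sinIncr a b m k i * sinIncr a b m k j / ((k : ℝ) + 1) ^ 2)
      ((π * ((b - a) / m) * (if i = j then 1 else 0) - ((b - a) / m) ^ 2) / 2) := by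
  have hi' : (i : ℝ) + 1 ≤ m := by exact_mod_cast hi
  have hj' : (j : ℝ) + 1 ≤ m := by exact_mod_cast hj
  have g1 := grid_mem_Icc ha hab hb (m := m) (r := (i : ℝ)) (by positivity) (by linarith)
  have g2 := grid_mem_Icc ha hab hb (m := m) (r := (i : ℝ) + 1) (by positivity) (by linarith)
  have g3 := grid_mem_Icc ha hab hb (m := m) (r := (j : ℝ)) (by positivity) (by linarith)
  have g4 := grid_mem_Icc ha hab hb (m := m) (r := (j : ℝ) + 1) (by positivity) (by linarith)
  have h0 : 0 ≤ (b - a) / m := div_nonneg (by linarith) (by positivity)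
  have hmin (r s : ℝ) : min (a + (b - a) * r / (m : ℝ)) (a + (b - a) * s / (m : ℝ)) =
      a + (b - a) / m * min r s := by
    rw [min_add_add_left, mul_div_right_comm, mul_div_right_comm, mul_min_of_nonneg _ _ h0]
  have h := ((hasSum_sin_mul_sin_div_sq g2 g4).sub (hasSum_sin_mul_sin_div_sq g2 g3)).sub
    ((hasSum_sin_mul_sin_div_sq g1 g4).sub (hasSum_sin_mul_sin_div_sq g1 g3))
  convert! h using 1
  · ext k
    unfold sinIncr
    ring
  · simp only [hmin]
    rcases lt_trichotomy i j with hij | hij | hij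
    · have : (i : ℝ) + 1 ≤ j := by exact_mod_cast hij
      rw [if_neg hij.ne, min_eq_left (by linarith : (i : ℝ) + 1 ≤ j + 1), min_eq_left this,
        min_eq_left (by linarith : (i : ℝ) ≤ j + 1), min_eq_left (by linarith : (i : ℝ) ≤ j)]
      ring
    · subst hij
      rw [if_pos rfl, min_self, min_self, min_eq_left (by linarith : (i : ℝ) ≤ i + 1),
        min_eq_right (by linarith : (i : ℝ) ≤ i + 1)]
      ring
    · have : (j : ℝ) + 1 ≤ i := by exact_mod_cast hij
      rw [if_neg hij.ne', min_eq_right (by linarith : (j : ℝ) + 1 ≤ i + 1), min_eq_right this,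
        min_eq_right (by linarith : (j : ℝ) ≤ i + 1), min_eq_right (by linarith : (j : ℝ) ≤ i)]
      ring

lemma hasSum_mul_sum_sq {ι : Type*} [Fintype ι] {w : ℕ → ℝ} {d : ℕ → ι → ℝ} {S : ι → ι → ℝ}
    (h : ∀ i j, HasSum (fun k => w k * d k i * d k j) (S i j)) (c : ι → ℝ) :
    HasSum (fun k => w k * (∑ i, c i * d k i) ^ 2) (∑ i, ∑ j, c i * c j * S i j) := by
  have := hasSum_sum (s := Finset.univ) fun i _ =>
    hasSum_sum (s := Finset.univ) fun j _ => (h i j).mul_left (c i * c j)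
  convert! this using 1
  ext k
  rw [sq, Finset.sum_mul_sum, Finset.mul_sum]
  refine Finset.sum_congr rfl fun i _ => ?_
  rw [Finset.mul_sum]
  exact Finset.sum_congr rfl fun j _ => by ring

/-- The weight of the `(k + 1)`-st mode in `heatCovSpace`. -/
def heatWeight (θ σ t : ℝ) (k : ℕ) : ℝ :=
  (σ ^ 2 / (θ * π * ((k : ℝ) + 1) ^ 2)) * (1 - Real.exp (-(2 * θ * ((k : ℝ) + 1) ^ 2 * t)))

lemma heatWeight_eq (θ σ t : ℝ) (k : ℕ) : heatWeight θ σ t k = σ ^ 2 / (θ * π) *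
    (1 / ((k : ℝ) + 1) ^ 2 - Real.exp (-(2 * θ * ((k : ℝ) + 1) ^ 2 * t)) / ((k : ℝ) + 1) ^ 2) := by
  rw [heatWeight, ← div_div]; ring

lemma summable_one_div_succ_sq : Summable (fun k : ℕ => 1 / ((k : ℝ) + 1) ^ 2) := by
  have := (summable_nat_add_iff 1).2 (Real.summable_one_div_nat_pow (p := 2) |>.2 one_lt_two)
  simpa using this

lemma heatWeight_nonneg {θ σ t : ℝ} (hθ : 0 < θ) (ht : 0 < t) (k : ℕ) :
    0 ≤ heatWeight θ σ t k := by
  have hπ := Real.pi_pos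
  refine mul_nonneg (by positivity) (sub_nonneg.2 (Real.exp_le_one_iff.2 ?_))
  have : 0 ≤ 2 * θ * ((k : ℝ) + 1) ^ 2 * t := by positivity
  linarith

lemma heatWeight_le {θ σ t : ℝ} (hθ : 0 < θ) (k : ℕ) :
    heatWeight θ σ t k ≤ σ ^ 2 / (θ * π) * (1 / ((k : ℝ) + 1) ^ 2) := by
  have hπ := Real.pi_pos
  rw [heatWeight_eq]
  gcongr
  have : 0 ≤ Real.exp (-(2 * θ * ((k : ℝ) + 1) ^ 2 * t)) / ((k : ℝ) + 1) ^ 2 := by positivity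
  linarith

lemma summable_heatWeight {θ σ t : ℝ} (hθ : 0 < θ) (ht : 0 < t) : Summable (heatWeight θ σ t) :=
  (summable_one_div_succ_sq.mul_left _).of_nonneg_of_le (heatWeight_nonneg hθ ht)
    (heatWeight_le hθ)

lemma Summable.mul_mul_of_bounded {w f g : ℕ → ℝ} {A B : ℝ} (hw : Summable w)
    (hw0 : ∀ k, 0 ≤ w k) (hf : ∀ k, |f k| ≤ A) (hg : ∀ k, |g k| ≤ B) :
    Summable fun k => w k * f k * g k := by
  refine Summable.of_norm_bounded (hw.mul_right (A * B)) fun k => ?_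
  rw [Real.norm_eq_abs, abs_mul, abs_mul, abs_of_nonneg (hw0 k), mul_assoc]
  have := (abs_nonneg _).trans (hf k)
  gcongr
  · exact hw0 k
  · exact hf k
  · exact hg k

lemma abs_sinIncr_le_two (a b : ℝ) (m k j : ℕ) : |sinIncr a b m k j| ≤ 2 := by
  unfold sinIncr
  refine (abs_sub _ _).trans ?_
  have := Real.abs_sin_le_one (((k : ℝ) + 1) * (a + (b - a) * ((j : ℝ) + 1) / (m : ℝ)))
  have := Real.abs_sin_le_one (((k : ℝ) + 1) * (a + (b - a) * (j : ℝ) / (m : ℝ)))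
  linarith

lemma abs_sinIncr_le {a b : ℝ} (hab : a < b) (m k j : ℕ) :
    |sinIncr a b m k j| ≤ ((k : ℝ) + 1) * ((b - a) / m) := by
  unfold sinIncr
  have h : LipschitzWith 1 Real.sin := Real.lipschitzWith_sin
  have := h.dist_le_mul (((k : ℝ) + 1) * (a + (b - a) * ((j : ℝ) + 1) / (m : ℝ)))
    (((k : ℝ) + 1) * (a + (b - a) * (j : ℝ) / (m : ℝ)))
  rw [Real.dist_eq, Real.dist_eq] at this
  refine this.trans (le_of_eq ?_)
  have h0 : 0 ≤ ((k : ℝ) + 1) * ((b - a) / m) :=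
    mul_nonneg (by positivity) (div_nonneg (by linarith) (by positivity))
  rw [NNReal.coe_one, one_mul, ← abs_of_nonneg h0]
  congr 1
  ring

/-- Covariance matrix of the increments over the uniform grid of a centered field with covariance
`heatCovSpace`. -/
def incrCov (θ σ t a b : ℝ) (m : ℕ) : Matrix (Fin m) (Fin m) ℝ :=
  fun i j => ∑' k, heatWeight θ σ t k * sinIncr a b m k i * sinIncr a b m k j

lemma hasSum_incrCov {θ σ t : ℝ} (hθ : 0 < θ) (ht : 0 < t) (a b : ℝ) (m : ℕ) (i j : Fin m) :
    HasSum (fun k => heatWeight θ σ t k * sinIncr a b m k i * sinIncr a b m k j)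
      (incrCov θ σ t a b m i j) :=
  ((summable_heatWeight hθ ht).mul_mul_of_bounded (heatWeight_nonneg hθ ht)
    (fun k => abs_sinIncr_le_two a b m k i) (fun k => abs_sinIncr_le_two a b m k j)).hasSum

lemma hasSum_incrCov_form {θ σ t : ℝ} (hθ : 0 < θ) (ht : 0 < t) (a b : ℝ) (m : ℕ)
    (c : Fin m → ℝ) :
    HasSum (fun k => heatWeight θ σ t k * (∑ i, c i * sinIncr a b m k i) ^ 2)
      (∑ i, ∑ j, c i * c j * incrCov θ σ t a b m i j) :=
  hasSum_mul_sum_sq (hasSum_incrCov hθ ht a b m) c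

lemma incrCov_form_nonneg {θ σ t : ℝ} (hθ : 0 < θ) (ht : 0 < t) (a b : ℝ) (m : ℕ)
    (c : Fin m → ℝ) : 0 ≤ ∑ i, ∑ j, c i * c j * incrCov θ σ t a b m i j :=
  (hasSum_incrCov_form hθ ht a b m c).nonneg
    fun k => mul_nonneg (heatWeight_nonneg hθ ht k) (sq_nonneg _)

lemma incrCov_form_le {θ σ t a b : ℝ} (hθ : 0 < θ) (ht : 0 < t) (ha : 0 ≤ a) (hab : a < b)
    (hb : b ≤ π) (m : ℕ) (c : Fin m → ℝ) :
    ∑ i, ∑ j, c i * c j * incrCov θ σ t a b m i j ≤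
      (b - a) * σ ^ 2 / (2 * θ) / m * ∑ i, c i ^ 2 := by
  have hπ := Real.pi_pos
  have h1 := hasSum_mul_sum_sq (ι := Fin m) (w := fun k => 1 / ((k : ℝ) + 1) ^ 2)
    (d := fun k i => sinIncr a b m k i) (fun i j => by
      convert hasSum_sinIncr_mul_div_sq ha hab hb i.2 j.2 using 2 with k
      ring) c
  have h2 := hasSum_le (fun k => ?_) (hasSum_incrCov_form (σ := σ) hθ ht a b m c)
    (h1.mul_left (σ ^ 2 / (θ * π)))
  · refine h2.trans ?_
    have e : ∑ i : Fin m, ∑ j : Fin m, c i * c j *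
        ((π * ((b - a) / m) * (if (i : ℕ) = j then 1 else 0) - ((b - a) / m) ^ 2) / 2) =
        π * ((b - a) / m) / 2 * ∑ i, c i ^ 2 - ((b - a) / m) ^ 2 / 2 * (∑ i, c i) ^ 2 := by
      rw [sq (∑ i, c i), Finset.sum_mul_sum, Finset.mul_sum, Finset.mul_sum,
        ← Finset.sum_sub_distrib]
      refine Finset.sum_congr rfl fun i _ => ?_
      have : π * ((b - a) / m) / 2 * c i ^ 2 =
          ∑ j : Fin m, (if i = j then π * ((b - a) / m) / 2 * (c i * c j) else 0) := by
        simp [sq]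
      rw [this, Finset.mul_sum, ← Finset.sum_sub_distrib]
      refine Finset.sum_congr rfl fun j _ => ?_
      simp only [Fin.ext_iff]
      split_ifs <;> ring
    rw [e]
    calc _ ≤ σ ^ 2 / (θ * π) * (π * ((b - a) / m) / 2 * ∑ i, c i ^ 2) := by
          gcongr
          have : 0 ≤ ((b - a) / m) ^ 2 / 2 * (∑ i, c i) ^ 2 := by positivity
          linarith
      _ = _ := by field_simp
  · rw [← mul_assoc]
    exact mul_le_mul_of_nonneg_right (heatWeight_le hθ k) (sq_nonneg _)

lemma summable_exp_neg_mul_succ_sq {r : ℝ} (hr : 0 < r) :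
    Summable fun k : ℕ => Real.exp (-(r * ((k : ℝ) + 1) ^ 2)) := by
  have hg : Summable fun k : ℕ => Real.exp (-r) ^ k :=
    summable_geometric_of_lt_one (Real.exp_nonneg _) (Real.exp_lt_one_iff.2 (by linarith))
  refine hg.of_nonneg_of_le (fun k => Real.exp_nonneg _) fun k => ?_
  rw [← Real.exp_nat_mul]
  refine Real.exp_le_exp.2 ?_
  have : (0 : ℝ) ≤ k := by positivity
  nlinarith [mul_nonneg hr.le (sq_nonneg (k : ℝ)), mul_nonneg hr.le this]

lemma exists_trace_incrCov_ge {θ σ t a b : ℝ} (hθ : 0 < θ) (ht : 0 < t) (ha : 0 ≤ a)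
    (hab : a < b) (hb : b ≤ π) :
    ∃ C : ℝ, ∀ m : ℕ, 0 < m →
      (b - a) * σ ^ 2 / (2 * θ) - (incrCov θ σ t a b m).trace ≤ C / m := by
  have hπ := Real.pi_pos
  set E : ℝ := ∑' k : ℕ, Real.exp (-(2 * θ * t * ((k : ℝ) + 1) ^ 2)) with hE
  have hEs := (summable_exp_neg_mul_succ_sq (r := 2 * θ * t) (by positivity)).hasSum
  rw [← hE] at hEs
  refine ⟨(b - a) ^ 2 * (σ ^ 2 / (θ * π)) * (1 / 2 + E), fun m hm => ?_⟩
  have hm' : (0 : ℝ) < m := by exact_mod_cast hm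
  have key (i : Fin m) : (b - a) * σ ^ 2 / (2 * θ) / m -
      ((b - a) / m) ^ 2 * (σ ^ 2 / (θ * π)) * (1 / 2 + E) ≤ incrCov θ σ t a b m i i := by
    have h1 := hasSum_sinIncr_mul_div_sq ha hab hb i.2 i.2
    have h2 := (h1.sub (hEs.mul_left (((b - a) / m) ^ 2))).mul_left (σ ^ 2 / (θ * π))
    refine le_trans (le_of_eq ?_) (hasSum_le (fun k => ?_) h2 (hasSum_incrCov hθ ht a b m i i))
    · rw [if_pos rfl]; field_simp; ring
    · rw [heatWeight_eq, mul_assoc _ (sinIncr a b m k i), mul_assoc (σ ^ 2 / (θ * π))]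
      gcongr
      rw [sub_mul]
      have hs : sinIncr a b m k i * sinIncr a b m k i ≤
          ((k : ℝ) + 1) ^ 2 * ((b - a) / m) ^ 2 := by
        rw [← mul_pow, ← sq, ← sq_abs]
        gcongr
        exact abs_sinIncr_le hab m k i
      have e1 : (2 * θ * t * ((k : ℝ) + 1) ^ 2) = 2 * θ * ((k : ℝ) + 1) ^ 2 * t := by ring
      rw [e1]
      have : Real.exp (-(2 * θ * ((k : ℝ) + 1) ^ 2 * t)) / ((k : ℝ) + 1) ^ 2 *
          (sinIncr a b m k i * sinIncr a b m k i) ≤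
          ((b - a) / m) ^ 2 * Real.exp (-(2 * θ * ((k : ℝ) + 1) ^ 2 * t)) := by
        calc _ ≤ Real.exp (-(2 * θ * ((k : ℝ) + 1) ^ 2 * t)) / ((k : ℝ) + 1) ^ 2 *
              (((k : ℝ) + 1) ^ 2 * ((b - a) / m) ^ 2) := by gcongr
          _ = _ := by field_simp
      have e2 : 1 / ((k : ℝ) + 1) ^ 2 * (sinIncr a b m k i * sinIncr a b m k i) =
        sinIncr a b m k i * sinIncr a b m k i / ((k : ℝ) + 1) ^ 2 := by ring
      linarith
  have hs := Finset.sum_le_sum fun i (_ : i ∈ Finset.univ) => key i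
  rw [Finset.sum_const, Finset.card_univ, Fintype.card_fin, nsmul_eq_mul] at hs
  have : (m : ℝ) * ((b - a) * σ ^ 2 / (2 * θ) / m -
      ((b - a) / m) ^ 2 * (σ ^ 2 / (θ * π)) * (1 / 2 + E)) = (b - a) * σ ^ 2 / (2 * θ) -
      (b - a) ^ 2 * (σ ^ 2 / (θ * π)) * (1 / 2 + E) / m := by
    field_simp
  rw [this] at hs
  simp only [Matrix.trace, Matrix.diag_apply]
  linarith

theorem memLp_sq_gaussianReal : MemLp (fun x : ℝ => x ^ 2) 2 (gaussianReal 0 1) := by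
  rw [memLp_two_iff_integrable_sq (by fun_prop)]
  have h := (memLp_id_gaussianReal (μ := 0) (v := 1) 4).integrable_norm_pow (by norm_num)
  refine h.congr (ae_of_all _ fun x => ?_)
  simp only [id, Real.norm_eq_abs, ← pow_mul]
  exact Even.pow_abs (by decide) x

theorem integral_sq_gaussianReal : ∫ x, x ^ 2 ∂(gaussianReal 0 1) = 1 := by
  have h := variance_eq_integral (μ := gaussianReal 0 1) (X := id) aemeasurable_id
  simpa using h.symm

theorem variance_sq_gaussianReal_pos : 0 < Var[fun x : ℝ => x ^ 2; gaussianReal 0 1] := by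
  refine (variance_nonneg _ _).lt_of_ne' fun h => ?_
  have hae := ae_eq_integral_of_variance_eq_zero memLp_sq_gaussianReal h
  rw [integral_sq_gaussianReal] at hae
  have : NullSingletonClass (gaussianReal 0 1) := nullSingletonClass_gaussianReal (by norm_num)
  have hnull : gaussianReal 0 1 {1, -1} = 0 := (Set.toFinite _).measure_zero _
  have hfalse : ∀ᵐ x ∂(gaussianReal 0 1), False := by
    filter_upwards [hae, compl_mem_ae_iff.2 hnull] with x hx hx'
    exact hx' (by simpa using sq_eq_one_iff.1 hx)
  exact hfalse.exists.elim fun _ h => h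

/-- Nonnegative functions whose integrals tend to zero converge to zero in measure. -/
theorem tendstoInMeasure_zero_of_integral_tendsto_zero {α : Type*} [MeasurableSpace α]
    {μ : Measure α} [IsFiniteMeasure μ] {f : ℕ → α → ℝ} (hf : ∀ n x, 0 ≤ f n x)
    (hint : ∀ n, Integrable (f n) μ) (hlim : Tendsto (fun n => ∫ x, f n x ∂μ) atTop (nhds 0)) :
    TendstoInMeasure μ f atTop (fun _ => 0) := by
  rw [tendstoInMeasure_iff_measureReal_norm]
  intro ε hε
  have hlim' := hlim.div_const ε
  rw [zero_div] at hlim'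
  refine squeeze_zero (fun n => measureReal_nonneg) (fun n => ?_) hlim'
  rw [le_div_iff₀ hε, mul_comm]
  simpa [abs_of_nonneg (hf n _)] using
    mul_meas_ge_le_integral_of_nonneg (ae_of_all _ (hf n)) (hint n) ε

theorem tendstoInMeasure_sub {ι α E : Type*} [MeasurableSpace α] {μ : Measure α}
    [SeminormedAddCommGroup E] {l : Filter ι} {f g : ι → α → E} {f' g' : α → E}
    (hf : TendstoInMeasure μ f l f') (hg : TendstoInMeasure μ g l g') :
    TendstoInMeasure μ (fun i x => f i x - g i x) l (fun x => f' x - g' x) := by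
  rw [tendstoInMeasure_iff_norm] at *
  intro ε hε
  have h := (hf (ε / 2) (half_pos hε)).add (hg (ε / 2) (half_pos hε))
  rw [add_zero] at h
  refine tendsto_of_tendsto_of_tendsto_of_le_of_le tendsto_const_nhds h (fun _ => zero_le)
    fun i => (measure_mono fun x hx => ?_).trans (measure_union_le _ _)
  by_contra hcon
  simp only [Set.mem_union, Set.mem_ofPred_eq, not_or, not_le] at hcon hx
  have := norm_sub_le (f i x - f' x) (g i x - g' x)
  rw [sub_sub_sub_comm] at this
  linarith [hcon.1, hcon.2]

theorem tendstoInDistribution_of_nonneg_perturbation {Ω : Type*} [MeasurableSpace Ω]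
    {μ : Measure Ω} [IsProbabilityMeasure μ] {X : ℕ → Ω → ℝ} (hX : ∀ i, Measurable (X i))
    (hlaw : ∀ i, HasLaw (X i) (gaussianReal 0 1) μ) (hindep : iIndepFun X μ)
    {θ c C : ℝ} (hc : 0 < c) {D : ℕ → Ω → ℝ}
    (hD : ∀ m, Measurable (D m)) (hD0 : ∀ m ω, 0 ≤ D m ω) (hDi : ∀ m, Integrable (D m) μ)
    (hDC : ∀ m : ℕ, 0 < m → ∫ ω, D m ω ∂μ ≤ C / m) :
    TendstoInDistribution
      (fun (m : ℕ) ω => √(m : ℝ) *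
        (θ * c / (c / m * ∑ k ∈ Finset.range m, X k ω ^ 2 - D m ω) - θ)) atTop
      (fun z => -θ * z) (fun _ => μ)
      (gaussianReal 0 Var[fun x : ℝ => x ^ 2; gaussianReal 0 1].toNNReal) := by
  have hmem : MemLp (fun ω => X 0 ω ^ 2) 2 μ :=
    MemLp.comp_of_map (g := fun x : ℝ => x ^ 2) (by rw [(hlaw 0).map_eq]; exact memLp_sq_gaussianReal)
      (hX 0).aemeasurable
  have hmean : ∫ ω, X 0 ω ^ 2 ∂μ = 1 := by
    rw [← integral_sq_gaussianReal, ← (hlaw 0).map_eq, integral_map (hX 0).aemeasurable (by fun_prop)]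
  have hvar : Var[fun ω => X 0 ω ^ 2; μ] = Var[fun x : ℝ => x ^ 2; gaussianReal 0 1] := by
    rw [← (hlaw 0).map_eq, variance_map (by fun_prop) (hX 0).aemeasurable]; rfl
  have hindep2 : iIndepFun (fun i ω => X i ω ^ 2) μ :=
    hindep.comp (fun _ x => x ^ 2) (fun _ => by fun_prop)
  have hident : ∀ i, IdentDistrib (fun ω => X i ω ^ 2) (fun ω => X 0 ω ^ 2) μ μ := fun i =>
    (IdentDistrib.mk (hX i).aemeasurable (hX 0).aemeasurable
      ((hlaw i).map_eq.trans (hlaw 0).map_eq.symm)).comp (u := fun x : ℝ => x ^ 2) (by fun_prop)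
  have hA := tendstoInDistribution_inv_sqrt_mul_sum_sub (P := μ)
    (P' := gaussianReal 0 Var[fun x : ℝ => x ^ 2; gaussianReal 0 1].toNNReal)
    (X := fun i ω => X i ω ^ 2) (Y := id) (by simpa only [hvar] using HasLaw.id) hmem hindep2 hident
  simp only [hmean, mul_one] at hA
  have hsD : TendstoInMeasure μ (fun (m : ℕ) ω => √(m : ℝ) * D m ω) atTop (fun _ => 0) := by
    refine tendstoInMeasure_zero_of_integral_tendsto_zero
      (fun m ω => mul_nonneg (sqrt_nonneg _) (hD0 m ω)) (fun m => (hDi m).const_mul _) ?_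
    have hlim : Tendsto (fun m : ℕ => C / √(m : ℝ)) atTop (nhds 0) :=
      tendsto_const_nhds.div_atTop (tendsto_sqrt_atTop.comp tendsto_natCast_atTop_atTop)
    refine squeeze_zero' (Eventually.of_forall fun m => integral_nonneg fun ω =>
      mul_nonneg (sqrt_nonneg _) (hD0 m ω)) ?_ hlim
    filter_upwards [eventually_gt_atTop 0] with m hm
    rw [integral_const_mul]
    calc √(m : ℝ) * ∫ ω, D m ω ∂μ ≤ √(m : ℝ) * (C / m) :=
          mul_le_mul_of_nonneg_left (hDC m hm) (sqrt_nonneg _)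
      _ = C / √(m : ℝ) := by
          have hm' : (0 : ℝ) < m := by exact_mod_cast hm
          have hs : 0 < √(m : ℝ) := sqrt_pos.2 hm'
          nth_rewrite 2 [← mul_self_sqrt hm'.le]
          field_simp
  have hD' : TendstoInMeasure μ D atTop (fun _ => 0) := by
    refine tendstoInMeasure_zero_of_integral_tendsto_zero hD0 hDi ?_
    refine squeeze_zero' (Eventually.of_forall fun m => integral_nonneg (hD0 m)) ?_
      (tendsto_const_nhds.div_atTop tendsto_natCast_atTop_atTop : Tendsto (fun m : ℕ => C / (m : ℝ)) atTop (nhds 0))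
    filter_upwards [eventually_gt_atTop 0] with m hm using hDC m hm
  have hL : TendstoInMeasure μ (fun (m : ℕ) ω => c / m * ∑ k ∈ Finset.range m, X k ω ^ 2) atTop
      (fun _ => c) := by
    refine tendstoInMeasure_of_tendsto_ae
      (fun m => (by fun_prop : Measurable _).aestronglyMeasurable) ?_
    have hlln := strong_law_ae_real (fun i ω => X i ω ^ 2) (hmem.integrable (by norm_num))
      (fun i j hij => hindep2.indepFun hij) hident
    filter_upwards [hlln] with ω hω
    rw [hmean] at hω
    have := hω.const_mul c
    rw [mul_one] at this
    refine this.congr fun m => ?_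
    ring
  have hQ : TendstoInMeasure μ (fun (m : ℕ) ω =>
      c / m * ∑ k ∈ Finset.range m, X k ω ^ 2 - D m ω) atTop (fun _ => c) := by
    simpa using tendstoInMeasure_sub hL hD'
  have hN := hA.continuous_comp_prodMk_of_tendstoInMeasure_const
    (g := fun p : ℝ × ℝ => -c * p.1 + p.2) (by fun_prop) hsD (fun m => by fun_prop)
  have hg : Continuous fun p : ℝ × ℝ => θ * p.1 / max p.2 (c / 2) := by
    refine Continuous.div (by fun_prop) (by fun_prop) fun p => ?_
    have := le_max_right p.2 (c / 2)
    linarith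
  have hY := hN.continuous_comp_prodMk_of_tendstoInMeasure_const hg hQ (fun m => by fun_prop)
  refine (tendstoInDistribution_of_tendstoInMeasure_sub _ _ hY ?_ ?_).congr
    (fun _ => Eventually.of_forall fun _ => rfl) (Eventually.of_forall fun z => ?_)
  · rw [tendstoInMeasure_iff_norm] at hQ ⊢
    intro ε hε
    refine tendsto_of_tendsto_of_tendsto_of_le_of_le' tendsto_const_nhds
      (hQ (c / 2) (by positivity)) (Eventually.of_forall fun _ => zero_le) ?_
    filter_upwards [eventually_gt_atTop 0] with m hm
    refine measure_mono fun ω hω => ?_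
    by_contra hcon
    simp only [Set.mem_ofPred_eq, not_le, Real.norm_eq_abs, abs_lt] at hcon
    refine not_lt.2 (Set.mem_ofPred_eq ▸ hω) ?_
    have hm' : (0 : ℝ) < m := by exact_mod_cast hm
    have hs : 0 < √(m : ℝ) := sqrt_pos.2 hm'
    have hmax : max (c / m * ∑ k ∈ Finset.range m, X k ω ^ 2 - D m ω) (c / 2) =
        c / m * ∑ k ∈ Finset.range m, X k ω ^ 2 - D m ω := max_eq_left (by linarith)
    have hpos : 0 < c / m * ∑ k ∈ Finset.range m, X k ω ^ 2 - D m ω := by linarith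
    simp only [Pi.sub_apply, Pi.zero_apply, sub_zero, hmax]
    refine lt_of_eq_of_lt ?_ hε
    rw [norm_eq_zero, sub_eq_zero, div_sub' hpos.ne', mul_div_assoc',
      div_left_inj' hpos.ne']
    generalize ∑ k ∈ Finset.range m, X k ω ^ 2 = S
    have hmm : (m : ℝ) = √(m : ℝ) * √(m : ℝ) := (mul_self_sqrt hm'.le).symm
    generalize √(m : ℝ) = r at *
    rw [hmm]
    field_simp
    ring
  · intro m
    fun_prop
  · simp only [id]
    rw [max_eq_left (by linarith)]
    field_simp
    ring

section MultivariateGaussian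

open scoped Matrix MatrixOrder

variable {ι : Type*} [Fintype ι]

lemma dotProduct_mulVec_eq_sum_sum (S : Matrix ι ι ℝ) (z : ι → ℝ) :
    z ⬝ᵥ S *ᵥ z = ∑ i, ∑ j, z i * z j * S i j := by
  simp only [dotProduct, Matrix.mulVec, Finset.mul_sum]
  exact Finset.sum_congr rfl fun i _ => Finset.sum_congr rfl fun j _ => by ring

variable [DecidableEq ι] {S : Matrix ι ι ℝ}

lemma norm_sq_toEuclideanCLM_sqrt (hS : S.PosSemidef) (z : EuclideanSpace ℝ ι) :
    ‖Matrix.toEuclideanCLM (𝕜 := ℝ) (CFC.sqrt S) z‖ ^ 2 = ∑ i, ∑ j, z i * z j * S i j := by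
  have hsa : IsSelfAdjoint (Matrix.toEuclideanCLM (n := ι) (𝕜 := ℝ) (CFC.sqrt S)) :=
    (CFC.sqrt_nonneg S).isSelfAdjoint.map _
  rw [← real_inner_self_eq_norm_sq, ← ContinuousLinearMap.adjoint_inner_right, hsa.adjoint_eq,
    ← ContinuousLinearMap.comp_apply, ← ContinuousLinearMap.mul_def, ← map_mul,
    CFC.sqrt_mul_sqrt_self _ hS.nonneg, Matrix.inner_toEuclideanCLM, dotProduct_mulVec_eq_sum_sum]

lemma integrable_norm_sq_multivariateGaussian (S : Matrix ι ι ℝ) :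
    Integrable (fun x => ‖x‖ ^ 2) (multivariateGaussian 0 S) :=
  (IsGaussian.memLp_two_id (μ := multivariateGaussian 0 S)).integrable_norm_pow (by norm_num)

lemma integral_norm_sq_multivariateGaussian (hS : S.PosSemidef) :
    ∫ x, ‖x‖ ^ 2 ∂(multivariateGaussian 0 S) = S.trace := by
  have hlaw (i : ι) := measurePreserving_eval_multivariateGaussian (μ := 0) hS (i := i)
  have hint (i : ι) : Integrable (fun x : EuclideanSpace ℝ ι => x i ^ 2)
      (multivariateGaussian 0 S) :=
    ((IsGaussian.memLp_two_id (μ := gaussianReal _ _)).comp_measurePreserving (hlaw i)).integrable_sq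
  simp_rw [EuclideanSpace.real_norm_sq_eq]
  rw [integral_finsetSum _ fun i _ => hint i]
  refine Finset.sum_congr rfl fun i _ => ?_
  rw [Matrix.diag_apply, ← variance_eval_multivariateGaussian (μ := 0) hS i, variance_of_integral_eq_zero]
  · exact (hlaw i).measurable.aemeasurable
  · rw [← integral_id_gaussianReal (μ := 0) (v := (S i i).toNNReal)]
    have := (hlaw i).map_eq
    simp only [PiLp.zero_apply] at this
    rw [← this, integral_map (hlaw i).measurable.aemeasurable (by fun_prop)]

/-- Cramér–Wold characterisation of centered multivariate Gaussian laws. -/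
lemma map_toLp_eq_multivariateGaussian {Ω : Type*} [MeasurableSpace Ω] {P : Measure Ω}
    [IsProbabilityMeasure P] {Y : ι → Ω → ℝ} (hY : ∀ i, AEMeasurable (Y i) P)
    (hS : S.PosSemidef)
    (h : ∀ c : ι → ℝ, P.map (fun ω => ∑ i, c i * Y i ω) =
      gaussianReal 0 (∑ i, ∑ j, c i * c j * S i j).toNNReal) :
    P.map (fun ω => WithLp.toLp 2 fun i => Y i ω) = multivariateGaussian 0 S := by
  have hm : AEMeasurable (fun ω => WithLp.toLp 2 fun i => Y i ω) P := by
    have : AEMeasurable (fun ω i => Y i ω) P := aemeasurable_pi_lambda _ hY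
    fun_prop
  have := Measure.isProbabilityMeasure_map hm
  refine Measure.ext_of_charFun (E := EuclideanSpace ℝ ι) (funext fun z => ?_)
  have hsum : AEMeasurable (fun ω => ∑ i, z i * Y i ω) P := by fun_prop
  have hz := charFun_gaussianReal (μ := 0) (v := (∑ i, ∑ j, z i * z j * S i j).toNNReal) 1
  rw [← h z, charFun_apply_real, integral_map hsum (by fun_prop)] at hz
  rw [charFun_multivariateGaussian hS, charFun_apply, integral_map hm (by fun_prop),
    dotProduct_mulVec_eq_sum_sum]
  have hnn : 0 ≤ ∑ i, ∑ j, z i * z j * S i j := by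
    rw [← norm_sq_toEuclideanCLM_sqrt hS]; positivity
  rw [coe_toNNReal _ hnn] at hz
  convert! hz using 3
  · simp [PiLp.inner_apply]
  · simp
  · simp

/-- The laws of `√m (θ c / ‖x‖² - θ)` under centered Gaussians whose covariance is bounded by, and
has nearly the same trace as, `(c / m) I`. -/
theorem tendsto_integral_multivariateGaussian {θ c C : ℝ} (hc : 0 < c)
    {S : ∀ m : ℕ, Matrix (Fin m) (Fin m) ℝ} (hS : ∀ m, (S m).PosSemidef)
    (hle : ∀ m (z : Fin m → ℝ), ∑ i, ∑ j, z i * z j * S m i j ≤ c / m * ∑ i, z i ^ 2)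
    (htr : ∀ m : ℕ, 0 < m → c - (S m).trace ≤ C / m) (f : BoundedContinuousFunction ℝ ℝ) :
    Tendsto (fun m : ℕ => ∫ x, f (√(m : ℝ) * (θ * c / ‖x‖ ^ 2 - θ)) ∂(multivariateGaussian 0 (S m)))
      atTop (nhds (∫ y, f y ∂(gaussianReal 0
        (θ ^ 2 * Var[fun x : ℝ => x ^ 2; gaussianReal 0 1]).toNNReal))) := by
  obtain ⟨Ω, _, μ, X, hX, hlaw, hindep, _⟩ := exists_iid ℕ (gaussianReal 0 1)
  let Z : ∀ m : ℕ, Ω → EuclideanSpace ℝ (Fin m) := fun m ω => WithLp.toLp 2 fun i => X i ω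
  let B (m : ℕ) := Matrix.toEuclideanCLM (n := Fin m) (𝕜 := ℝ) (CFC.sqrt (S m))
  have hZ (m : ℕ) : Measurable (Z m) := by fun_prop
  have hZlaw (m : ℕ) : μ.map (Z m) = stdGaussian (EuclideanSpace ℝ (Fin m)) := by
    rw [← map_pi_eq_stdGaussian, ← ((hindep.precomp Fin.val_injective).hasLaw_pi
      fun i : Fin m => hlaw i).map_eq, Measure.map_map (by fun_prop) (by fun_prop)]
    rfl
  have hBZ (m : ℕ) : Measurable fun ω => B m (Z m ω) := (B m).continuous.measurable.comp (hZ m)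
  have hBlaw (m : ℕ) : μ.map (fun ω => B m (Z m ω)) = multivariateGaussian 0 (S m) := by
    rw [multivariateGaussian, ← hZlaw, Measure.map_map (by fun_prop) (hZ m)]
    congr 1
    ext1 ω
    simp [B]
  have hZn (m : ℕ) (ω : Ω) : ‖Z m ω‖ ^ 2 = ∑ k ∈ Finset.range m, X k ω ^ 2 := by
    rw [EuclideanSpace.real_norm_sq_eq, Finset.sum_range]
  let D : ℕ → Ω → ℝ := fun m ω => c / m * ‖Z m ω‖ ^ 2 - ‖B m (Z m ω)‖ ^ 2
  have hiZ (m : ℕ) : Integrable (fun ω => ‖Z m ω‖ ^ 2) μ := by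
    have := integrable_norm_sq_multivariateGaussian (1 : Matrix (Fin m) (Fin m) ℝ)
    rw [multivariateGaussian_zero_one, ← hZlaw] at this
    exact this.comp_measurable (hZ m)
  have hiB (m : ℕ) : Integrable (fun ω => ‖B m (Z m ω)‖ ^ 2) μ := by
    have := integrable_norm_sq_multivariateGaussian (S m)
    rw [← hBlaw] at this
    exact this.comp_measurable (hBZ m)
  have heZ (m : ℕ) : ∫ ω, ‖Z m ω‖ ^ 2 ∂μ = m := by
    have := integral_norm_sq_multivariateGaussian (Matrix.PosSemidef.one (n := Fin m) (R := ℝ))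
    rw [multivariateGaussian_zero_one, ← hZlaw, integral_map (hZ m).aemeasurable (by fun_prop)] at this
    simpa using this
  have heB (m : ℕ) : ∫ ω, ‖B m (Z m ω)‖ ^ 2 ∂μ = (S m).trace := by
    rw [← integral_norm_sq_multivariateGaussian (hS m), ← hBlaw,
      integral_map (hBZ m).aemeasurable (by fun_prop)]
  have hmain := tendstoInDistribution_of_nonneg_perturbation (θ := θ) (C := C) hX hlaw hindep hc (D := D)
    (fun m => by fun_prop) (fun m ω => ?_) (fun m => ((hiZ m).const_mul _).sub (hiB m))
    (fun m hm => ?_)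
  · have h := ProbabilityMeasure.tendsto_iff_forall_integral_tendsto.1 hmain.tendsto f
    simp only [ProbabilityMeasure.coe_mk] at h
    have hv := variance_nonneg (fun x : ℝ => x ^ 2) (gaussianReal 0 1)
    rw [gaussianReal_map_const_mul] at h
    convert! h using 2 with m
    · have hfm : Measurable fun x : EuclideanSpace ℝ (Fin m) =>
          f (√(m : ℝ) * (θ * c / ‖x‖ ^ 2 - θ)) := f.continuous.measurable.comp (by fun_prop)
      rw [← hBlaw, integral_map (hBZ m).aemeasurable hfm.aestronglyMeasurable,
        integral_map (hmain.forall_aemeasurable m) (by fun_prop)]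
      simp [D, hZn]
    · congr 2
      · simp
      · ext
        simp only [NNReal.coe_mul, NNReal.coe_mk]
        rw [coe_toNNReal _ hv, coe_toNNReal _ (by positivity)]
        ring
  · rw [sub_nonneg, norm_sq_toEuclideanCLM_sqrt (hS m), EuclideanSpace.real_norm_sq_eq]
    exact hle m _
  · have hm' : (m : ℝ) ≠ 0 := by exact_mod_cast hm.ne'
    rw [integral_sub ((hiZ m).const_mul _) (hiB m), integral_const_mul, heZ, heB,
      div_mul_cancel₀ _ hm']
    exact htr m hm

end MultivariateGaussian

lemma IsCenteredGaussianField.aemeasurable {Ω : Type*} [MeasurableSpace Ω] {P : Measure Ω}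
    {u : ℝ → Ω → ℝ} {S : Set ℝ} {C : ℝ → ℝ → ℝ} (hu : IsCenteredGaussianField P u S C) {x : ℝ}
    (hx : x ∈ S) : AEMeasurable (u x) P := by
  have h := hu 1 (fun _ => x) (fun _ => hx) (fun _ => 1)
  simp only [Finset.univ_unique, Finset.sum_singleton, one_mul] at h
  refine AEMeasurable.of_map_ne_zero ?_
  rw [h]
  exact IsProbabilityMeasure.ne_zero _

lemma hasSum_heatCovSpace {θ σ t : ℝ} (hθ : 0 < θ) (ht : 0 < t) (x y : ℝ) :
    HasSum (fun k : ℕ => heatWeight θ σ t k * Real.sin (((k : ℝ) + 1) * x) *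
      Real.sin (((k : ℝ) + 1) * y)) (heatCovSpace θ σ t x y) :=
  ((summable_heatWeight hθ ht).mul_mul_of_bounded (heatWeight_nonneg hθ ht)
    (fun _ => Real.abs_sin_le_one _) (fun _ => Real.abs_sin_le_one _)).hasSum

lemma incrCov_posSemidef {θ σ t : ℝ} (hθ : 0 < θ) (ht : 0 < t) (a b : ℝ) (m : ℕ) :
    (incrCov θ σ t a b m).PosSemidef := by
  refine Matrix.PosSemidef.of_dotProduct_mulVec_nonneg ?_ fun c => ?_
  · ext i j
    simp only [Matrix.conjTranspose_apply, star_trivial, incrCov]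
    exact tsum_congr fun k => by ring
  · rw [star_trivial, dotProduct_mulVec_eq_sum_sum]
    exact incrCov_form_nonneg hθ ht a b m c

/-- Linear combinations of the increments of the field are Gaussian. -/
lemma map_sum_increments_eq_gaussianReal {Ω : Type*} [MeasurableSpace Ω] {P : Measure Ω}
    {θ σ t a b : ℝ} (hθ : 0 < θ) (ht : 0 < t) (ha : 0 ≤ a) (hab : a < b) (hb : b ≤ π)
    {u : ℝ → Ω → ℝ} (hu : IsCenteredGaussianField P u (Set.Icc 0 π) (heatCovSpace θ σ t))
    (m : ℕ) (c : Fin m → ℝ) :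
    P.map (fun ω => ∑ j : Fin m, c j * (u (a + (b - a) * ((j : ℝ) + 1) / m) ω -
      u (a + (b - a) * (j : ℝ) / m) ω)) =
      gaussianReal 0 (∑ i, ∑ j, c i * c j * incrCov θ σ t a b m i j).toNNReal := by
  let x : Fin (m + m) → ℝ := Fin.append (fun j : Fin m => a + (b - a) * ((j : ℝ) + 1) / m)
    (fun j : Fin m => a + (b - a) * (j : ℝ) / m)
  let d : Fin (m + m) → ℝ := Fin.append c (-c)
  have hx : ∀ i, x i ∈ Set.Icc 0 π := by
    refine Fin.addCases (fun j => ?_) fun j => ?_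
    · simp only [x, Fin.append_left]
      exact grid_mem_Icc ha hab hb (by positivity) (by exact_mod_cast j.2)
    · simp only [x, Fin.append_right]
      exact grid_mem_Icc ha hab hb (by positivity) (by exact_mod_cast j.2.le)
  have h := hu (m + m) x hx d
  have hvar : ∑ i, ∑ j, d i * d j * heatCovSpace θ σ t (x i) (x j) =
      ∑ i, ∑ j, c i * c j * incrCov θ σ t a b m i j := by
    refine (hasSum_mul_sum_sq (d := fun k i => Real.sin (((k : ℝ) + 1) * x i))
      (fun i j => hasSum_heatCovSpace (σ := σ) hθ ht (x i) (x j)) d).unique ?_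
    convert! hasSum_incrCov_form (σ := σ) hθ ht a b m c using 4 with k
    rw [Fin.sum_univ_add, ← Finset.sum_add_distrib]
    refine Finset.sum_congr rfl fun j _ => ?_
    simp only [x, d, Fin.append_left, Fin.append_right, sinIncr, Pi.neg_apply]
    ring
  rw [hvar] at h
  rw [← h]
  congr 1
  ext ω
  rw [Fin.sum_univ_add, ← Finset.sum_add_distrib]
  refine Finset.sum_congr rfl fun j _ => ?_
  simp only [x, d, Fin.append_left, Fin.append_right, Pi.neg_apply]
  ring

lemma hasLaw_increments_multivariateGaussian {Ω : Type*} [MeasurableSpace Ω] {P : Measure Ω}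
    [IsProbabilityMeasure P] {θ σ t a b : ℝ} (hθ : 0 < θ) (ht : 0 < t) (ha : 0 ≤ a) (hab : a < b)
    (hb : b ≤ π) {u : ℝ → Ω → ℝ}
    (hu : IsCenteredGaussianField P u (Set.Icc 0 π) (heatCovSpace θ σ t)) (m : ℕ) :
    HasLaw (fun ω => WithLp.toLp 2 fun j : Fin m => u (a + (b - a) * ((j : ℝ) + 1) / m) ω -
      u (a + (b - a) * (j : ℝ) / m) ω) (multivariateGaussian 0 (incrCov θ σ t a b m)) P := by
  have hm (j : Fin m) : AEMeasurable (fun ω => u (a + (b - a) * ((j : ℝ) + 1) / m) ω -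
      u (a + (b - a) * (j : ℝ) / m) ω) P :=
    (hu.aemeasurable (grid_mem_Icc ha hab hb (by positivity) (by exact_mod_cast j.2))).sub
      (hu.aemeasurable (grid_mem_Icc ha hab hb (by positivity) (by exact_mod_cast j.2.le)))
  have hpi := aemeasurable_pi_lambda _ hm
  exact ⟨by fun_prop, map_toLp_eq_multivariateGaussian hm (incrCov_posSemidef hθ ht a b m)
    (map_sum_increments_eq_gaussianReal hθ ht ha hab hb hu m)⟩

/-- Asymptotic normality, with rate `√m`, of the drift estimator `θ̂_{m,t}` built from the
spatial quadratic variation of the stochastic heat equation observed at a fixed time `t`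
on the uniform grid of `[a,b] ⊂ [0,π]` (weak convergence tested against bounded continuous
functions). -/
theorem stmt15 {Ω : Type*} [MeasurableSpace Ω] (P : Measure Ω) [IsProbabilityMeasure P]
    (θ σ t a b : ℝ) (hθ : 0 < θ) (hσ : 0 < σ) (ht : 0 < t)
    (ha : 0 ≤ a) (hab : a < b) (hb : b ≤ π)
    (u : ℝ → Ω → ℝ)
    (hu : IsCenteredGaussianField P u (Set.Icc 0 π) (heatCovSpace θ σ t)) :
    ∃ V : ℝ, 0 < V ∧ ∀ f : BoundedContinuousFunction ℝ ℝ,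
      Tendsto (fun (m : ℕ) => ∫ ω,
          f (Real.sqrt (m : ℝ) *
            ((b - a) * σ ^ 2 /
              (2 * ∑ j ∈ Finset.range m,
                (u (a + (b - a) * ((j : ℝ) + 1) / (m : ℝ)) ω
                  - u (a + (b - a) * (j : ℝ) / (m : ℝ)) ω) ^ 2) - θ)) ∂P)
        atTop (nhds (∫ y, f y ∂(gaussianReal 0 V.toNNReal))) := by
  obtain ⟨C, hC⟩ := exists_trace_incrCov_ge (σ := σ) hθ ht ha hab hb
  have hc : 0 < (b - a) * σ ^ 2 / (2 * θ) := by
    have := sub_pos.2 hab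
    positivity
  have hv := variance_sq_gaussianReal_pos
  refine ⟨θ ^ 2 * Var[fun x : ℝ => x ^ 2; gaussianReal 0 1], by positivity, fun f => ?_⟩
  refine (tendsto_integral_multivariateGaussian (θ := θ) hc
    (fun m => incrCov_posSemidef (σ := σ) hθ ht a b m)
    (fun m z => incrCov_form_le hθ ht ha hab hb m z) hC f).congr fun m => ?_
  have hlaw := hasLaw_increments_multivariateGaussian hθ ht ha hab hb hu m
  have hfm : Measurable fun x : EuclideanSpace ℝ (Fin m) =>
      f (√(m : ℝ) * (θ * ((b - a) * σ ^ 2 / (2 * θ)) / ‖x‖ ^ 2 - θ)) :=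
    f.continuous.measurable.comp (by fun_prop)
  rw [← hlaw.map_eq, integral_map hlaw.aemeasurable hfm.aestronglyMeasurable]
  refine integral_congr_ae (Eventually.of_forall fun ω => ?_)
  simp only [EuclideanSpace.real_norm_sq_eq, Finset.sum_range]
  rw [show θ * ((b - a) * σ ^ 2 / (2 * θ)) = (b - a) * σ ^ 2 / 2 by field_simp, div_div]
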